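/- arXiv:2310.04684 — 6 statements merged into one kernel-verified Lean document; each statement's English description precedes it below -/
import Mathlib

section
/- Let t be a predicate on a set S and B a deterministic relation on S, with guarded body G = {(s,s') ∈ B | t(s)}. Then the loop function W = G* ∩ {(s,s') | ¬t(s')} is deterministic: if (s,s') ∈ W and (s,s'') ∈ W then s' = s''. -/
/-- If B is deterministic, then the loop function
    W = G* ∩ {(s,s') | ¬t(s')} is deterministic. -/
theorem stmt_6 {S : Type*} (t : S → Prop) (B : S → S → Prop)
    (hB : ∀ s s' s'', B s s' → B s s'' → s' = s'') :
    ∀ s s' s'',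
      (Relation.ReflTransGen (fun a b => t a ∧ B a b) s s' ∧ ¬ t s') →
      (Relation.ReflTransGen (fun a b => t a ∧ B a b) s s'' ∧ ¬ t s'') →
      s' = s'' := by
  rintro s s' s'' ⟨h₁, ht₁⟩ ⟨h₂, ht₂⟩
  induction h₁ using Relation.ReflTransGen.head_induction_on with
  | refl =>
    rcases h₂.cases_head with h | ⟨_, ⟨ht, _⟩, _⟩
    · exact h
    · exact absurd ht ht₁
  | head hab _ ih =>
    rcases h₂.cases_head with h | ⟨_, hac, hc⟩
    · exact absurd (h ▸ hab.1) ht₂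
    · exact ih (hB _ _ _ hac.2 hab.2 ▸ hc)
end

section
/- Let t be a predicate on a set S and B a deterministic relation on S, with guarded body G = {(s,s') ∈ B | t(s)} and loop function W = G* ∩ {(s,s') | ¬t(s')}. Let R be an invariant relation of the loop (t,B). Then W = R ∩ {(s,s') | ¬t(s')} if and only if (i) R ∩ {(s,s') | ¬t(s')} is deterministic, and (ii) dom(R ∩ {(s,s') | ¬t(s')}) ⊆ dom(W). -/
/-- An invariant relation of the loop (t,B): a reflexive transitive relation
    containing the guarded body G = {(s,s') ∈ B | t(s)}. -/
def InvariantRelation {S : Type*} (t : S → Prop) (B : S → S → Prop)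
    (R : S → S → Prop) : Prop :=
  Reflexive R ∧ Transitive R ∧ ∀ s s', t s → B s s' → R s s'

/-- A guarded iteration started outside the guard does not move. -/
theorem eq_of_reflTransGen_of_not_guard {S : Type*} {t : S → Prop} {B : S → S → Prop} {a b : S}
    (ha : ¬ t a) (h : Relation.ReflTransGen (fun a b => t a ∧ B a b) a b) : a = b := by
  rcases h.cases_head with h | ⟨c, hc, -⟩
  · exact h
  · exact absurd hc.1 ha

/-- A reflexive transitive relation containing the guarded body contains its closure. -/
theorem InvariantRelation.of_reflTransGen {S : Type*} {t : S → Prop} {B R : S → S → Prop}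
    (hR : InvariantRelation t B R) {a b : S}
    (h : Relation.ReflTransGen (fun a b => t a ∧ B a b) a b) : R a b := by
  obtain ⟨hrefl, htrans, hbody⟩ := hR
  induction h with
  | refl => exact hrefl a
  | tail _ hbc ih => exact htrans ih (hbody _ _ hbc.1 hbc.2)

/-- The loop function of a deterministic body is deterministic. -/
theorem loop_function_deterministic {S : Type*} {t : S → Prop} {B : S → S → Prop}
    (hB : ∀ s s' s'', B s s' → B s s'' → s' = s'') {s a b : S}
    (ha : Relation.ReflTransGen (fun a b => t a ∧ B a b) s a) (hta : ¬ t a)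
    (hb : Relation.ReflTransGen (fun a b => t a ∧ B a b) s b) (htb : ¬ t b) : a = b := by
  have hG : Relator.RightUnique (fun a b => t a ∧ B a b) :=
    fun x y z hy hz => hB x y z hy.2 hz.2
  rcases Relation.ReflTransGen.total_of_right_unique hG ha hb with h | h
  · exact eq_of_reflTransGen_of_not_guard hta h
  · exact (eq_of_reflTransGen_of_not_guard htb h).symm

/-- For B deterministic and R an invariant relation of (t,B),
    W = R ∩ ¬T' iff R ∩ ¬T' is deterministic and dom(R ∩ ¬T') ⊆ dom(W),
    where W = G* ∩ {(s,s') | ¬t(s')}. -/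
theorem stmt_7 {S : Type*} (t : S → Prop) (B : S → S → Prop)
    (hB : ∀ s s' s'', B s s' → B s s'' → s' = s'')
    (R : S → S → Prop) (hR : InvariantRelation t B R) :
    (∀ s s',
        (Relation.ReflTransGen (fun a b => t a ∧ B a b) s s' ∧ ¬ t s') ↔
        (R s s' ∧ ¬ t s')) ↔
    ((∀ s s' s'', (R s s' ∧ ¬ t s') → (R s s'' ∧ ¬ t s'') → s' = s'') ∧
      ({s | ∃ s', R s s' ∧ ¬ t s'} ⊆
        {s | ∃ s', Relation.ReflTransGen (fun a b => t a ∧ B a b) s s' ∧ ¬ t s'})) := by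
  constructor
  · intro hW
    refine ⟨fun s a b ha hb => ?_, fun s ⟨a, ha⟩ => ⟨a, (hW s a).2 ha⟩⟩
    obtain ⟨ha, hta⟩ := (hW s a).2 ha
    obtain ⟨hb, htb⟩ := (hW s b).2 hb
    exact loop_function_deterministic hB ha hta hb htb
  · rintro ⟨hdet, hdom⟩ s a
    refine ⟨fun ⟨h, ht⟩ => ⟨hR.of_reflTransGen h, ht⟩, fun ha => ?_⟩
    obtain ⟨b, hb, htb⟩ := hdom ⟨a, ha⟩
    obtain rfl := hdet s a b ha ⟨hR.of_reflTransGen hb, htb⟩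
    exact ⟨hb, htb⟩
end

section
/- Consider the state space S = ℕ × ℕ × ℕ with states s = (n,f,k), the guard t(n,f,k) = (k ≠ n+1), and the guarded factorial loop body G = {((n,f,k),(n',f',k')) | 1 ≤ k ∧ k ≠ n+1 ∧ n' = n ∧ f' = f·k ∧ k' = k+1}. Then the loop function W = G* ∩ {(s,s') | k' = n'+1} satisfies: W = {((n,f,k),(n',f',k')) | 1 ≤ k ∧ k ≤ n+1 ∧ n' = n ∧ k' = n+1 ∧ f'·(k−1)! = n!·f}. -/
/-- The guarded body of the factorial loop 'while (k ≠ n+1) {f := f*k; k := k+1}',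
    with k assumed at least 1. -/
def G10 : ℕ × ℕ × ℕ → ℕ × ℕ × ℕ → Prop := fun (n, f, k) (n', f', k') =>
  1 ≤ k ∧ k ≠ n + 1 ∧ n' = n ∧ f' = f * k ∧ k' = k + 1

theorem mul_factorial_pred_eq_iff {k : ℕ} (hk : 1 ≤ k) (n f f' : ℕ) :
    f' * Nat.factorial k = Nat.factorial n * (f * k) ↔
      f' * Nat.factorial (k - 1) = Nat.factorial n * f := by
  rw [← Nat.mul_factorial_pred (by omega : k ≠ 0), Nat.mul_left_comm, ← Nat.mul_assoc _ f k,
    Nat.mul_comm _ k]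
  exact Nat.mul_right_inj (by omega)

theorem closed_form_of_reflTransGen_G10 {s s' : ℕ × ℕ × ℕ} (h : Relation.ReflTransGen G10 s s')
    (hs' : s'.2.2 = s'.1 + 1) :
    1 ≤ s.2.2 ∧ s.2.2 ≤ s.1 + 1 ∧ s'.1 = s.1 ∧ s'.2.2 = s.1 + 1 ∧
      s'.2.1 * Nat.factorial (s.2.2 - 1) = Nat.factorial s.1 * s.2.1 := by
  induction h using Relation.ReflTransGen.head_induction_on with
  | refl => simp [hs', Nat.mul_comm]
  | head hstep _ ih =>
    rename_i a c _
    obtain ⟨n, f, k⟩ := a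
    obtain ⟨m, g, l⟩ := c
    obtain ⟨hk, hne, rfl, rfl, rfl⟩ := hstep
    obtain ⟨-, hle, hn, hk', hf⟩ := ih
    exact ⟨hk, by simp at hle ⊢; omega, hn, hk', (mul_factorial_pred_eq_iff hk _ _ _).1 hf⟩

theorem reflTransGen_G10_of_closed_form {n f' k : ℕ} (hkn : k ≤ n + 1) :
    ∀ f, 1 ≤ k → f' * Nat.factorial (k - 1) = Nat.factorial n * f →
      Relation.ReflTransGen G10 (n, f, k) (n, f', n + 1) := by
  induction hkn using Nat.decreasingInduction with
  | self =>
    intro f _ hf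
    rw [Nat.add_sub_cancel, Nat.mul_comm] at hf
    rw [Nat.eq_of_mul_eq_mul_left (Nat.factorial_pos n) hf]
  | of_succ k hlt ih =>
    intro f hk hf
    exact .head (show G10 (n, f, k) (n, f * k, k + 1) from ⟨hk, hlt.ne, rfl, rfl, rfl⟩)
      (ih _ (by omega) ((mul_factorial_pred_eq_iff hk _ _ _).2 hf))

/-- The loop function W = G* ∩ {(s,s') | k' = n'+1} of the
    factorial loop equals the stated closed form. -/
theorem stmt_10 :
    ∀ n f k n' f' k' : ℕ,
      (Relation.ReflTransGen G10 (n, f, k) (n', f', k') ∧ k' = n' + 1) ↔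
      (1 ≤ k ∧ k ≤ n + 1 ∧ n' = n ∧ k' = n + 1 ∧
        f' * Nat.factorial (k - 1) = Nat.factorial n * f) := by
  intro n f k n' f' k'
  constructor
  · rintro ⟨h, hk'⟩
    exact closed_form_of_reflTransGen_G10 h hk'
  · rintro ⟨hk, hkn, rfl, rfl, hf⟩
    exact ⟨reflTransGen_G10_of_closed_form hkn f hk hf, rfl⟩
end

section
/- Consider the state space S = ℕ × ℕ × ℕ with states s = (n,f,k), the guard t'(n,f,k) = (k < n+1), and the guarded loop body G' = {((n,f,k),(n',f',k')) | 1 ≤ k ∧ k < n+1 ∧ n' = n ∧ f' = f·k ∧ k' = k+1} (the loop 'while (k < n+1) {f := f·k; k := k+1}', with k assumed at least 1). Then the loop function V = G'* ∩ {(s,s') | ¬(k' < n'+1)} satisfies: V = {((n,f,k),(n',f',k')) | k ≥ n+1 ∧ n' = n ∧ f' = f ∧ k' = k} ∪ {((n,f,k),(n',f',k')) | 1 ≤ k ∧ k < n+1 ∧ n' = n ∧ k' = n+1 ∧ f'·(k−1)! = n!·f}. -/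
/-- The guarded body of the loop 'while (k < n+1) {f := f*k; k := k+1}',
    with k assumed at least 1. -/
def G11 : ℕ × ℕ × ℕ → ℕ × ℕ × ℕ → Prop := fun (n, f, k) (n', f', k') =>
  1 ≤ k ∧ k < n + 1 ∧ n' = n ∧ f' = f * k ∧ k' = k + 1

theorem G11_reflTransGen_invariant {s t : ℕ × ℕ × ℕ} (h : Relation.ReflTransGen G11 s t) :
    t = s ∨ (1 ≤ s.2.2 ∧ s.2.2 < s.1 + 1 ∧ t.1 = s.1 ∧ 1 ≤ t.2.2 ∧ t.2.2 ≤ s.1 + 1 ∧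
      t.2.1 * Nat.factorial (s.2.2 - 1) = Nat.factorial (t.2.2 - 1) * s.2.1) := by
  induction h with
  | refl => exact Or.inl rfl
  | @tail b c _ hstep ih =>
    obtain ⟨n, f, k⟩ := s
    obtain ⟨nb, fb, kb⟩ := b
    obtain ⟨nc, fc, kc⟩ := c
    obtain ⟨hk, hlt, rfl, rfl, rfl⟩ := hstep
    right
    have hfac : Nat.factorial kb = kb * Nat.factorial (kb - 1) :=
      (Nat.mul_factorial_pred (by omega)).symm
    rcases ih with heq | ⟨h1, h2, h3, h4, h5, h6⟩
    · simp only [Prod.mk.injEq] at heq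
      obtain ⟨rfl, rfl, rfl⟩ := heq
      refine ⟨hk, hlt, rfl, by simp, by simpa using hlt, ?_⟩
      simp only [Nat.add_sub_cancel, hfac]
      ring
    · simp only at h1 h2 h3 h4 h5 h6
      subst h3
      refine ⟨h1, h2, rfl, by simp, by simpa using hlt, ?_⟩
      simp only [Nat.add_sub_cancel, hfac]
      rw [mul_right_comm, h6]
      ring

theorem exists_G11_reflTransGen_exit (n f k : ℕ) (hk : 1 ≤ k) (hkn : k ≤ n + 1) :
    ∃ g, Relation.ReflTransGen G11 (n, f, k) (n, g, n + 1) := by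
  induction hkn using Nat.decreasingInduction generalizing f with
  | self => exact ⟨f, .refl⟩
  | of_succ k hlt ih =>
    obtain ⟨g, hg⟩ := ih (f * k) (by omega)
    exact ⟨g, .head ⟨hk, hlt, rfl, rfl, rfl⟩ hg⟩

/-- The loop function V = G'* ∩ {(s,s') | ¬(k' < n'+1)}
    equals the stated two-case closed form. -/
theorem stmt_11 :
    ∀ n f k n' f' k' : ℕ,
      (Relation.ReflTransGen G11 (n, f, k) (n', f', k') ∧ ¬ (k' < n' + 1)) ↔
      ((k ≥ n + 1 ∧ n' = n ∧ f' = f ∧ k' = k) ∨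
       (1 ≤ k ∧ k < n + 1 ∧ n' = n ∧ k' = n + 1 ∧
         f' * Nat.factorial (k - 1) = Nat.factorial n * f)) := by
  intro n f k n' f' k'
  constructor
  · rintro ⟨h, hexit⟩
    rcases G11_reflTransGen_invariant h with heq | ⟨h1, h2, h3, h4, h5, h6⟩
    · simp only [Prod.mk.injEq] at heq
      obtain ⟨rfl, rfl, rfl⟩ := heq
      exact Or.inl ⟨by omega, rfl, rfl, rfl⟩
    · simp only at h1 h2 h3 h4 h5 h6
      obtain rfl : k' = n + 1 := by omega
      exact Or.inr ⟨h1, h2, h3, rfl, by simpa using h6⟩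
  · rintro (⟨hk, rfl, rfl, rfl⟩ | ⟨h1, h2, rfl, rfl, hf⟩)
    · exact ⟨.refl, by omega⟩
    · obtain ⟨g, hg⟩ := exists_G11_reflTransGen_exit n' f k h1 h2.le
      refine ⟨?_, lt_irrefl _⟩
      rcases G11_reflTransGen_invariant hg with heq | ⟨-, -, -, -, -, h6⟩
      · simp only [Prod.mk.injEq] at heq
        omega
      · simp only [Nat.add_sub_cancel] at h6
        obtain rfl : g = f' :=
          Nat.eq_of_mul_eq_mul_right (Nat.factorial_pos (k - 1)) (h6.trans hf.symm)
        exact hg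
end

section
/- Let a be a nonzero integer constant. On the state space ℤ with states x, the relation R = {(x,x') | a·x ≤ a·x' ∧ x mod |a| = x' mod |a|} (where |a| is the absolute value of a and mod is the integer modulo operation) is a reflexive transitive relation containing the body relation B = {(x,x') | x' = x + a} (recognizer 1R3). -/
/-- recognizer 1R3: for a ≠ 0, the relation
    R = {(x,x') | a·x ≤ a·x' ∧ x mod |a| = x' mod |a|} is reflexive, transitive,
    and contains B = {(x,x') | x' = x + a}. -/
theorem stmt_13 (a : ℤ) (ha : a ≠ 0) :
    Reflexive (fun (x x' : ℤ) => a * x ≤ a * x' ∧ x % |a| = x' % |a|) ∧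
    Transitive (fun (x x' : ℤ) => a * x ≤ a * x' ∧ x % |a| = x' % |a|) ∧
    ∀ x x' : ℤ, x' = x + a → (a * x ≤ a * x' ∧ x % |a| = x' % |a|) := by
  refine ⟨fun x => ⟨le_rfl, rfl⟩,
    fun x y z hxy hyz => ⟨hxy.1.trans hyz.1, hxy.2.trans hyz.2⟩, ?_⟩
  rintro x _ rfl
  refine ⟨by nlinarith [mul_self_nonneg a], ?_⟩
  simp only [Int.emod_abs, Int.add_emod_right]
end

section
/- Let Fib : ℕ → ℕ denote the Fibonacci function with Fib(0) = 0, Fib(1) = 1, Fib(n+2) = Fib(n) + Fib(n+1), coerced into ℤ. On the state space ℤ × ℤ × ℤ with states (x,y,i), the relation R = {((x,y,i),(x',y',i')) | i ≤ i' ∧ x' = x·Fib((i'−i+1)) + y·Fib(i'−i) ∧ y' = x·Fib(i'−i) + y·Fib(|i'−i−1|)} (where the Fibonacci arguments i'−i+1 and i'−i are nonnegative since i ≤ i', and |i'−i−1| is the absolute value) is a reflexive transitive relation containing the body relation B = {((x,y,i),(x',y',i')) | x' = x + y ∧ y' = x ∧ i' = i + 1} (recognizer 3R2). -/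
/-- The invariant relation of recognizer 3R2, on states (x,y,i) ∈ ℤ × ℤ × ℤ. -/
def R17 : ℤ × ℤ × ℤ → ℤ × ℤ × ℤ → Prop := fun (x, y, i) (x', y', i') =>
  i ≤ i' ∧
  x' = x * (Nat.fib (i' - i + 1).toNat : ℤ) + y * (Nat.fib (i' - i).toNat : ℤ) ∧
  y' = x * (Nat.fib (i' - i).toNat : ℤ) + y * (Nat.fib (i' - i - 1).natAbs : ℤ)

/-- The body relation of recognizer 3R2. -/
def B17 : ℤ × ℤ × ℤ → ℤ × ℤ × ℤ → Prop := fun (x, y, i) (x', y', i') =>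
  x' = x + y ∧ y' = x ∧ i' = i + 1

theorem natCast_fib_natAbs_sub_one (n : ℕ) :
    (Nat.fib ((n : ℤ) - 1).natAbs : ℤ) = Nat.fib (n + 1) - Nat.fib n := by
  cases n with
  | zero => simp
  | succ n => simp [Nat.fib_add_two]

theorem natCast_fib_add (m n : ℕ) :
    (Nat.fib (m + n) : ℤ) =
      Nat.fib m * Nat.fib (n + 1) + Nat.fib (m + 1) * Nat.fib n - Nat.fib m * Nat.fib n := by
  have h₁ := Nat.fib_add m n
  have h₂ := Nat.fib_add m (n + 1)
  rw [← add_assoc, Nat.fib_add_two, Nat.fib_add_two] at h₂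
  zify at h₁ h₂
  linear_combination h₂ - h₁

theorem R17_iff (x y i x' y' i' : ℤ) :
    R17 (x, y, i) (x', y', i') ↔ ∃ n : ℕ, i' = i + n ∧
      x' = x * Nat.fib (n + 1) + y * Nat.fib n ∧
      y' = x * Nat.fib n + y * (Nat.fib (n + 1) - Nat.fib n) := by
  have shift (n : ℕ) : R17 (x, y, i) (x', y', i + n) ↔
      x' = x * Nat.fib (n + 1) + y * Nat.fib n ∧
      y' = x * Nat.fib n + y * (Nat.fib (n + 1) - Nat.fib n) := by
    have h : ((n : ℤ) + 1).toNat = n + 1 := by omega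
    simp [R17, natCast_fib_natAbs_sub_one, h]
  constructor
  · intro h
    obtain ⟨n, rfl⟩ := Int.le.dest h.1
    exact ⟨n, rfl, (shift n).1 h⟩
  · rintro ⟨n, rfl, h⟩
    exact (shift n).2 h

/-- recognizer 3R2: R17 is reflexive, transitive, and contains B17. -/
theorem stmt_17 :
    Reflexive R17 ∧ Transitive R17 ∧ ∀ s s', B17 s s' → R17 s s' := by
  refine ⟨?_, ?_, ?_⟩
  · rintro ⟨x, y, i⟩
    exact (R17_iff ..).2 ⟨0, by simp⟩
  · rintro ⟨x, y, i⟩ ⟨x', y', i'⟩ ⟨x'', y'', i''⟩ h₁ h₂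
    obtain ⟨m, rfl, rfl, rfl⟩ := (R17_iff ..).1 h₁
    obtain ⟨n, rfl, rfl, rfl⟩ := (R17_iff ..).1 h₂
    refine (R17_iff ..).2 ⟨m + n, by push_cast; ring, ?_, ?_⟩ <;>
    · rw [Nat.fib_add m n, natCast_fib_add m n]
      push_cast
      ring
  · rintro ⟨x, y, i⟩ ⟨x', y', i'⟩ ⟨rfl, rfl, rfl⟩
    exact (R17_iff ..).2 ⟨1, by simp⟩
end
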